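/- Let R be a finite ring, M a finite Frobenius bimodule over R with generating character χ, and U a subgroup of GL_n(R). Then the orbit partition of R^n under the right action r ↦ rU equals the χ-right dual partition of the orbit partition of M^n under the left action v ↦ (U vᵀ)ᵀ. In particular both actions have the same number of orbits, and all four orbit partitions (left/right actions on R^n and M^n) are reflexive. -/

import Mathlib

open MulOpposite Classical

/-- `χ` is a (two-sided) generating character of the finite `(R,R)`-bimodule `M`. -/
def IsGenChar (R M : Type*) [Ring R] [AddCommGroup M]
    [Module R M] [Module Rᵐᵒᵖ M] (χ : AddChar M ℂˣ) : Prop :=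
  (Function.Injective fun r : R => fun v : M => χ (op r • v)) ∧
  (∀ ψ : AddChar M ℂˣ, ∃ r : R, ∀ v : M, ψ v = χ (op r • v)) ∧
  (Function.Injective fun r : R => fun v : M => χ (r • v)) ∧
  (∀ ψ : AddChar M ℂˣ, ∃ r : R, ∀ v : M, ψ v = χ (r • v))

noncomputable section

variable (R M : Type*) [Ring R] [Fintype R] [AddCommGroup M] [Fintype M]
  [Module R M] [Module Rᵐᵒᵖ M] [SMulCommClass R Rᵐᵒᵖ M]
  (χ : AddChar M ℂˣ) (n : ℕ) (𝒰 : Subgroup (Matrix (Fin n) (Fin n) R)ˣ)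

/-- Orbit relation of the right action `r ↦ rU` of `𝒰 ≤ GL_n(R)` on `R^n`. -/
def rightOrbitR (r r' : Fin n → R) : Prop :=
  ∃ U ∈ 𝒰, r' = Matrix.vecMul r U.val

/-- Orbit relation of the left action `r ↦ (U rᵀ)ᵀ` of `𝒰 ≤ GL_n(R)` on `R^n`. -/
def leftOrbitR (r r' : Fin n → R) : Prop :=
  ∃ U ∈ 𝒰, r' = Matrix.mulVec U.val r

/-- Orbit relation of the right action `v ↦ vU` of `𝒰 ≤ GL_n(R)` on `M^n`. -/
def rightOrbitM (v v' : Fin n → M) : Prop :=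
  ∃ U ∈ 𝒰, ∀ j : Fin n, v' j = ∑ i : Fin n, op (U.val i j) • v i

/-- Orbit relation of the left action `v ↦ (U vᵀ)ᵀ` of `𝒰 ≤ GL_n(R)` on `M^n`. -/
def leftOrbitM (v v' : Fin n → M) : Prop :=
  ∃ U ∈ 𝒰, ∀ i : Fin n, v' i = ∑ j : Fin n, U.val i j • v j

/-- The `χ`-left dual (a partition of `M^n`) of a partition `P` of `R^n`, given as the
relation `v ~ v' ⟺ ∀ blocks P_k, ∑_{r ∈ P_k} χ⟨r,v⟩ = ∑_{r ∈ P_k} χ⟨r,v'⟩`. -/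
def dualLRM (P : (Fin n → R) → (Fin n → R) → Prop) (v v' : Fin n → M) : Prop :=
  ∀ r₀ : Fin n → R,
    ∑ r ∈ Finset.univ.filter (P r₀), ((χ (∑ i : Fin n, r i • v i) : ℂˣ) : ℂ) =
    ∑ r ∈ Finset.univ.filter (P r₀), ((χ (∑ i : Fin n, r i • v' i) : ℂˣ) : ℂ)

/-- The `χ`-right dual (a partition of `M^n`) of a partition `P` of `R^n`, given as the
relation `v ~ v' ⟺ ∀ blocks P_k, ∑_{r ∈ P_k} χ⟨v,r⟩ = ∑_{r ∈ P_k} χ⟨v',r⟩`. -/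
def dualRRM (P : (Fin n → R) → (Fin n → R) → Prop) (v v' : Fin n → M) : Prop :=
  ∀ r₀ : Fin n → R,
    ∑ r ∈ Finset.univ.filter (P r₀), ((χ (∑ i : Fin n, op (r i) • v i) : ℂˣ) : ℂ) =
    ∑ r ∈ Finset.univ.filter (P r₀), ((χ (∑ i : Fin n, op (r i) • v' i) : ℂˣ) : ℂ)

/-- The `χ`-left dual (a partition of `R^n`) of a partition `Q` of `M^n`, given as the
relation `r ~ r' ⟺ ∀ blocks Q_k, ∑_{v ∈ Q_k} χ⟨v,r⟩ = ∑_{v ∈ Q_k} χ⟨v,r'⟩`. -/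
def dualLMR (Q : (Fin n → M) → (Fin n → M) → Prop) (r r' : Fin n → R) : Prop :=
  ∀ v₀ : Fin n → M,
    ∑ v ∈ Finset.univ.filter (Q v₀), ((χ (∑ i : Fin n, op (r i) • v i) : ℂˣ) : ℂ) =
    ∑ v ∈ Finset.univ.filter (Q v₀), ((χ (∑ i : Fin n, op (r' i) • v i) : ℂˣ) : ℂ)

/-- The `χ`-right dual (a partition of `R^n`) of a partition `Q` of `M^n`, given as the
relation `r ~ r' ⟺ ∀ blocks Q_k, ∑_{v ∈ Q_k} χ⟨r,v⟩ = ∑_{v ∈ Q_k} χ⟨r',v⟩`. -/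
def dualRMR (Q : (Fin n → M) → (Fin n → M) → Prop) (r r' : Fin n → R) : Prop :=
  ∀ v₀ : Fin n → M,
    ∑ v ∈ Finset.univ.filter (Q v₀), ((χ (∑ i : Fin n, r i • v i) : ℂˣ) : ℂ) =
    ∑ v ∈ Finset.univ.filter (Q v₀), ((χ (∑ i : Fin n, r' i • v i) : ℂˣ) : ℂ)

/-- A perfect pairing of two finite abelian groups with values in `ℂ`. -/
structure IsCharPairing {A B : Type*} [AddCommGroup A] [AddCommGroup B] (e : A → B → ℂ) :
    Prop where
  add_left : ∀ a a' b, e (a + a') b = e a b * e a' b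
  add_right : ∀ a b b', e a (b + b') = e a b * e a b'
  zero_left : ∀ b, e 0 b = 1
  zero_right : ∀ a, e a 0 = 1
  inj_left : ∀ a a', (∀ b, e a b = e a' b) → a = a'
  inj_right : ∀ b b', (∀ a, e a b = e a b') → b = b'

/-- The dual, with respect to `e`, of a relation `Q` on `B`. -/
def charDual {A B : Type*} [Fintype B] (e : A → B → ℂ) (Q : B → B → Prop) (a a' : A) : Prop :=
  ∀ b₀ : B, ∑ b ∈ Finset.univ.filter (Q b₀), e a b = ∑ b ∈ Finset.univ.filter (Q b₀), e a' b

theorem charDual_equivalence {A B : Type*} [Fintype B] (e : A → B → ℂ) (Q : B → B → Prop) :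
    Equivalence (charDual e Q) :=
  ⟨fun _ _ => rfl, fun h b => (h b).symm, fun h h' b => (h b).trans (h' b)⟩

/-- Weighted sums agree when the weight is constant on classes and all class sums agree. -/
theorem sum_mul_eq_of_class_sums_eq {B : Type*} [Fintype B] {Q : B → B → Prop}
    (hQ : Equivalence Q) (c f f' : B → ℂ) (hc : ∀ b b', Q b b' → c b = c b')
    (h : ∀ b₀, ∑ b ∈ Finset.univ.filter (Q b₀), f b = ∑ b ∈ Finset.univ.filter (Q b₀), f' b) :
    ∑ b, c b * f b = ∑ b, c b * f' b := by
  rw [← sub_eq_zero, ← Finset.sum_sub_distrib]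
  refine Finset.sum_cancels_of_partition_cancels (⟨Q, hQ⟩ : Setoid B) fun b₀ _ => ?_
  have key : ∀ b ∈ Finset.univ.filter (Q b₀),
      c b * f b - c b * f' b = c b₀ * (f b - f' b) := fun b hb => by
    rw [← hc b₀ b (Finset.mem_filter.1 hb).2, mul_sub]
  have hfilter : (Finset.univ.filter fun b => (⟨Q, hQ⟩ : Setoid B) b b₀) =
      Finset.univ.filter (Q b₀) :=
    Finset.filter_congr fun b _ => ⟨fun hb => hQ.symm hb, fun hb => hQ.symm hb⟩
  rw [hfilter, Finset.sum_congr rfl key, ← Finset.mul_sum, Finset.sum_sub_distrib, h, sub_self,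
    mul_zero]

/-- A permutation preserving the classes of `Q` and adjoint to `a ↦ a'` puts `a` and `a'` in the
same class of the dual. -/
theorem charDual_of_adjoint {A B : Type*} [Fintype B] {e : A → B → ℂ} {Q : B → B → Prop}
    (hQ : Equivalence Q) {a a' : A} (g : B → B) (hg : Function.Injective g)
    (hQg : ∀ b, Q b (g b)) (h : ∀ b, e a' b = e a (g b)) : charDual e Q a a' := fun b₀ => by
  symm
  refine Finset.sum_equiv (Equiv.ofBijective g (Finite.injective_iff_bijective.1 hg))
    (fun b => ?_) fun b _ => h b
  simp only [Finset.mem_filter, Finset.mem_univ, true_and, Equiv.ofBijective_apply]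
  exact ⟨fun hb => hQ.trans hb (hQg b), fun hb => hQ.trans hb (hQ.symm (hQg b))⟩

/-- The classes of a relation, as sets, are counted by its quotient. -/
theorem card_classes_eq {A : Type*} {P : A → A → Prop} (hP : Equivalence P) :
    Nat.card {S : Set A // ∃ a, S = {a' | P a a'}} = Nat.card (Quotient (⟨P, hP⟩ : Setoid A)) := by
  refine (Nat.card_congr (Setoid.quotientEquivClasses ⟨P, hP⟩)).symm ▸ ?_
  refine Nat.card_congr (Equiv.subtypeEquivRight fun S => ?_)
  refine exists_congr fun a => ?_
  have : {a' | P a a'} = {x | (⟨P, hP⟩ : Setoid A) x a} :=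
    Set.ext fun x => ⟨fun hx => hP.symm hx, fun hx => hP.symm hx⟩
  rw [this]

namespace IsCharPairing

variable {A B : Type*} [AddCommGroup A] [AddCommGroup B] {e : A → B → ℂ}

theorem flip (he : IsCharPairing e) : IsCharPairing fun b a => e a b :=
  ⟨fun b b' a => he.add_right a b b', fun b a a' => he.add_left a a' b, he.zero_right,
    he.zero_left, he.inj_right, he.inj_left⟩

/-- The character of `B` defined by an element of `A`. -/
def toAddChar (he : IsCharPairing e) (a : A) : AddChar B ℂ where
  toFun := e a
  map_zero_eq_one' := he.zero_right a
  map_add_eq_mul' := he.add_right a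

theorem toAddChar_apply (he : IsCharPairing e) (a : A) (b : B) : he.toAddChar a b = e a b := rfl

theorem toAddChar_injective (he : IsCharPairing e) : Function.Injective he.toAddChar :=
  fun a a' h => he.inj_left a a' fun b => DFunLike.congr_fun h b

theorem card_le [Finite B] (he : IsCharPairing e) : Nat.card A ≤ Nat.card B := by
  have := Fintype.ofFinite B
  have := Nat.card_le_card_of_injective _ he.toAddChar_injective
  rwa [Nat.card_eq_fintype_card (α := AddChar B ℂ), AddChar.card_eq,
    ← Nat.card_eq_fintype_card] at this

theorem toAddChar_surjective [Finite A] [Finite B] (he : IsCharPairing e) :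
    Function.Surjective he.toAddChar := by
  have := Fintype.ofFinite B
  refine (Nat.bijective_iff_injective_and_card _).2 ⟨he.toAddChar_injective, ?_⟩ |>.2
  rw [Nat.card_eq_fintype_card (α := AddChar B ℂ), AddChar.card_eq, ← Nat.card_eq_fintype_card]
  exact le_antisymm he.card_le he.flip.card_le

theorem sum_conj_mul [Fintype B] (he : IsCharPairing e) (x y : A) :
    ∑ b, (starRingEnd ℂ) (e x b) * e y b = if x = y then (Fintype.card B : ℂ) else 0 := by
  have key : ∀ b, (starRingEnd ℂ) (e x b) * e y b = he.toAddChar (y - x) b := fun b => by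
    have h : e (y - x) b * e x b = e y b := by rw [← he.add_left, sub_add_cancel]
    have h1 : e x (-b) * e x b = 1 := by rw [← he.add_right, neg_add_cancel, he.zero_right]
    rw [← he.toAddChar_apply x b, ← AddChar.map_neg_eq_conj, toAddChar_apply, toAddChar_apply, ← h]
    linear_combination e (y - x) b * h1
  have hz : he.toAddChar (y - x) = 0 ↔ x = y := by
    rw [← (show he.toAddChar 0 = 0 from DFunLike.ext _ _ he.zero_left), he.toAddChar_injective.eq_iff,
      sub_eq_zero, eq_comm]
  simp only [key, AddChar.sum_eq_ite, hz]

variable [Fintype A] [Fintype B] {P : A → A → Prop} {Q : B → B → Prop}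

/-- If `Q` refines the dual of `P`, then the dual of `Q` refines `P`. -/
theorem rel_of_charDual (he : IsCharPairing e) (hP : Equivalence P) (hQ : Equivalence Q)
    (hQP : ∀ b b', Q b b' → charDual (fun b a => e a b) P b b') {a a' : A}
    (h : charDual e Q a a') : P a a' := by
  have hsum : ∀ y, ∑ b, (∑ x ∈ Finset.univ.filter (P a), (starRingEnd ℂ) (e x b)) * e y b =
      if P a y then (Fintype.card B : ℂ) else 0 := fun y => by
    simp only [Finset.sum_mul]
    rw [Finset.sum_comm]
    simp [he.sum_conj_mul]
  have heq := sum_mul_eq_of_class_sums_eq hQ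
    (fun b => ∑ x ∈ Finset.univ.filter (P a), (starRingEnd ℂ) (e x b)) (e a) (e a')
    (fun b b' hb => by simpa only [map_sum] using congrArg (starRingEnd ℂ) (hQP b b' hb a)) h
  rw [hsum, hsum, if_pos (hP.refl a)] at heq
  by_contra hn
  rw [if_neg hn] at heq
  exact Nat.cast_ne_zero.2 Fintype.card_ne_zero heq

/-- The Fourier transform embeds functions on classes of `P` into functions on classes of `Q`. -/
theorem card_quotient_le (he : IsCharPairing e) (hP : Equivalence P) (hQ : Equivalence Q)
    (hQP : ∀ b b', Q b b' → charDual (fun b a => e a b) P b b') :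
    Nat.card (Quotient (⟨P, hP⟩ : Setoid A)) ≤ Nat.card (Quotient (⟨Q, hQ⟩ : Setoid B)) := by
  let F : (Quotient (⟨P, hP⟩ : Setoid A) → ℂ) →ₗ[ℂ] (Quotient (⟨Q, hQ⟩ : Setoid B) → ℂ) :=
    { toFun := fun c => Quotient.lift (fun b => ∑ a, c (Quotient.mk _ a) * e a b) fun b b' hb =>
        sum_mul_eq_of_class_sums_eq hP _ _ _
          (fun a a' ha => congrArg c (Quotient.sound ha)) (hQP b b' hb)
      map_add' := fun c d => by
        funext q
        induction q using Quotient.inductionOn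
        simp [add_mul, Finset.sum_add_distrib]
      map_smul' := fun k c => by
        funext q
        induction q using Quotient.inductionOn
        simp [mul_assoc, Finset.mul_sum] }
  have hF : Function.Injective F := by
    refine (injective_iff_map_eq_zero F).2 fun c hc => ?_
    have hli := (AddChar.linearIndependent B ℂ).comp _ he.toAddChar_injective
    rw [Fintype.linearIndependent_iff] at hli
    funext q
    induction q using Quotient.inductionOn with | _ a
    refine hli (fun a => c (Quotient.mk _ a)) (funext fun b => ?_) a
    rw [Finset.sum_apply]
    exact congrFun hc (Quotient.mk _ b)
  have := LinearMap.finrank_le_finrank_of_injective hF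
  rwa [Module.finrank_fintype_fun_eq_card, Module.finrank_fintype_fun_eq_card,
    ← Nat.card_eq_fintype_card, ← Nat.card_eq_fintype_card] at this

end IsCharPairing

/-- The relation of lying in the same orbit of a set of endomorphisms. -/
def endOrbit {A : Type*} [AddCommGroup A] (S : Set (AddMonoid.End A)) (a a' : A) : Prop :=
  ∃ g ∈ S, a' = g a

/-- A set of endomorphisms forming a group with the identity of `A` as its unit. -/
structure IsEndGroup {A : Type*} [AddCommGroup A] (S : Set (AddMonoid.End A)) : Prop where
  one_mem : 1 ∈ S
  mul_mem : ∀ g ∈ S, ∀ h ∈ S, g * h ∈ S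
  exists_inv : ∀ g ∈ S, ∃ h ∈ S, h * g = 1

namespace IsEndGroup

variable {A B : Type*} [AddCommGroup A] [AddCommGroup B] {S : Set (AddMonoid.End A)}
  {T : Set (AddMonoid.End B)} {e : A → B → ℂ}

theorem equivalence (hS : IsEndGroup S) : Equivalence (endOrbit S) where
  refl _ := ⟨1, hS.one_mem, rfl⟩
  symm := by
    rintro a _ ⟨g, hg, rfl⟩
    obtain ⟨h, hh, hgh⟩ := hS.exists_inv g hg
    exact ⟨h, hh, (DFunLike.congr_fun hgh a).symm⟩
  trans := by
    rintro a _ _ ⟨g, hg, rfl⟩ ⟨h, hh, rfl⟩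
    exact ⟨h * g, hS.mul_mem h hh g hg, rfl⟩

theorem injective (hS : IsEndGroup S) {g : AddMonoid.End A} (hg : g ∈ S) :
    Function.Injective g := by
  obtain ⟨h, -, hgh⟩ := hS.exists_inv g hg
  exact Function.LeftInverse.injective (g := h) fun a => DFunLike.congr_fun hgh a

/-- Orbits of adjoint groups are contained in the dual of each other's orbits. -/
theorem charDual_of_endOrbit [Fintype B] (hT : IsEndGroup T)
    (hST : ∀ g ∈ S, ∃ h ∈ T, ∀ a b, e (g a) b = e a (h b)) {a a' : A}
    (ha : endOrbit S a a') : charDual e (endOrbit T) a a' := by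
  obtain ⟨g, hg, rfl⟩ := ha
  obtain ⟨h, hh, hgh⟩ := hST g hg
  exact charDual_of_adjoint hT.equivalence h (hT.injective hh) (fun b => ⟨h, hh, rfl⟩) (hgh a)

/-- The orbit partition of a group of automorphisms is reflexive. -/
theorem endOrbit_iff_bidual [Fintype A] [Fintype B] (hS : IsEndGroup S) (he : IsCharPairing e)
    (a a' : A) :
    endOrbit S a a' ↔ charDual e (charDual (fun b a => e a b) (endOrbit S)) a a' := by
  refine ⟨?_, he.rel_of_charDual hS.equivalence (charDual_equivalence _ _) fun _ _ => id⟩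
  rintro ⟨g, hg, rfl⟩
  have hadj : ∀ b, ∃ b', ∀ x, e (g x) b = e x b' := fun b => by
    obtain ⟨b', hb'⟩ := he.flip.toAddChar_surjective ((he.flip.toAddChar b).compAddMonoidHom g)
    exact ⟨b', fun x => (DFunLike.congr_fun hb' x).symm⟩
  choose h hh using hadj
  have hsurj : Function.Surjective g := Finite.injective_iff_surjective.1 (hS.injective hg)
  refine charDual_of_adjoint (charDual_equivalence _ _) h (fun b b' hb => ?_) (fun b => ?_) (hh · a)
  · refine he.inj_right b b' fun x => ?_
    obtain ⟨y, rfl⟩ := hsurj x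
    rw [hh, hh, hb]
  · exact charDual_of_adjoint hS.equivalence g (hS.injective hg) (fun x => ⟨g, hg, rfl⟩)
      fun x => (hh b x).symm

end IsEndGroup

section MatrixActions

variable {R M : Type*} [Ring R] [AddCommGroup M] {n : ℕ}

/-- The left action of a matrix on row vectors. -/
def leftEnd (M : Type*) [AddCommGroup M] [Module R M] (U : Matrix (Fin n) (Fin n) R) :
    AddMonoid.End (Fin n → M) where
  toFun v i := ∑ j, U i j • v j
  map_zero' := by ext; simp
  map_add' v w := by ext; simp [Finset.sum_add_distrib]

/-- The right action of a matrix on row vectors. -/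
def rightEnd (M : Type*) [AddCommGroup M] [Module Rᵐᵒᵖ M] (U : Matrix (Fin n) (Fin n) R) :
    AddMonoid.End (Fin n → M) where
  toFun v j := ∑ i, op (U i j) • v i
  map_zero' := by ext; simp
  map_add' v w := by ext; simp [Finset.sum_add_distrib]

theorem leftEnd_apply [Module R M] (U : Matrix (Fin n) (Fin n) R) (v : Fin n → M) (i : Fin n) :
    leftEnd M U v i = ∑ j, U i j • v j := rfl

theorem rightEnd_apply [Module Rᵐᵒᵖ M] (U : Matrix (Fin n) (Fin n) R) (v : Fin n → M) (j : Fin n) :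
    rightEnd M U v j = ∑ i, op (U i j) • v i := rfl

theorem leftEnd_one [Module R M] : leftEnd M (1 : Matrix (Fin n) (Fin n) R) = 1 := by
  refine DFunLike.ext _ _ fun v => funext fun i => ?_
  simp [leftEnd_apply, Matrix.one_apply, ite_smul]

theorem rightEnd_one [Module Rᵐᵒᵖ M] : rightEnd M (1 : Matrix (Fin n) (Fin n) R) = 1 := by
  refine DFunLike.ext _ _ fun v => funext fun i => ?_
  rw [rightEnd_apply, Finset.sum_eq_single i (fun j _ hj => by simp [Matrix.one_apply_ne hj])
    (by simp)]
  simp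

theorem leftEnd_mul [Module R M] (U V : Matrix (Fin n) (Fin n) R) :
    leftEnd M U * leftEnd M V = leftEnd M (U * V) := by
  refine DFunLike.ext _ _ fun v => funext fun i => ?_
  change leftEnd M U (leftEnd M V v) i = _
  simp only [leftEnd_apply, Matrix.mul_apply, Finset.sum_smul, Finset.smul_sum, mul_smul]
  exact Finset.sum_comm

theorem rightEnd_mul [Module Rᵐᵒᵖ M] (U V : Matrix (Fin n) (Fin n) R) :
    rightEnd M U * rightEnd M V = rightEnd M (V * U) := by
  refine DFunLike.ext _ _ fun v => funext fun i => ?_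
  change rightEnd M U (rightEnd M V v) i = _
  simp only [rightEnd_apply, Matrix.mul_apply, Finset.op_sum, op_mul, Finset.sum_smul,
    Finset.smul_sum, mul_smul]
  exact Finset.sum_comm

/-- The endomorphisms of row vectors given by the left action of a matrix group. -/
def leftEnds (M : Type*) [AddCommGroup M] [Module R M]
    (𝒰 : Subgroup (Matrix (Fin n) (Fin n) R)ˣ) : Set (AddMonoid.End (Fin n → M)) :=
  {g | ∃ U ∈ 𝒰, g = leftEnd M U.val}

/-- The endomorphisms of row vectors given by the right action of a matrix group. -/
def rightEnds (M : Type*) [AddCommGroup M] [Module Rᵐᵒᵖ M]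
    (𝒰 : Subgroup (Matrix (Fin n) (Fin n) R)ˣ) : Set (AddMonoid.End (Fin n → M)) :=
  {g | ∃ U ∈ 𝒰, g = rightEnd M U.val}

theorem isEndGroup_leftEnds [Module R M] (𝒰 : Subgroup (Matrix (Fin n) (Fin n) R)ˣ) :
    IsEndGroup (leftEnds M 𝒰) where
  one_mem := ⟨1, 𝒰.one_mem, leftEnd_one.symm⟩
  mul_mem := by
    rintro _ ⟨U, hU, rfl⟩ _ ⟨V, hV, rfl⟩
    exact ⟨U * V, 𝒰.mul_mem hU hV, leftEnd_mul _ _⟩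
  exists_inv := by
    rintro _ ⟨U, hU, rfl⟩
    exact ⟨_, ⟨U⁻¹, 𝒰.inv_mem hU, rfl⟩, by rw [leftEnd_mul, Units.inv_mul, leftEnd_one]⟩

theorem isEndGroup_rightEnds [Module Rᵐᵒᵖ M] (𝒰 : Subgroup (Matrix (Fin n) (Fin n) R)ˣ) :
    IsEndGroup (rightEnds M 𝒰) where
  one_mem := ⟨1, 𝒰.one_mem, rightEnd_one.symm⟩
  mul_mem := by
    rintro _ ⟨U, hU, rfl⟩ _ ⟨V, hV, rfl⟩
    exact ⟨V * U, 𝒰.mul_mem hV hU, rightEnd_mul _ _⟩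
  exists_inv := by
    rintro _ ⟨U, hU, rfl⟩
    exact ⟨_, ⟨U⁻¹, 𝒰.inv_mem hU, rfl⟩, by rw [rightEnd_mul, Units.mul_inv, rightEnd_one]⟩

theorem leftOrbitM_eq [Module R M] (𝒰 : Subgroup (Matrix (Fin n) (Fin n) R)ˣ) :
    leftOrbitM R M n 𝒰 = endOrbit (leftEnds M 𝒰) := by
  funext v v'
  exact propext ⟨fun ⟨U, hU, h⟩ => ⟨_, ⟨U, hU, rfl⟩, funext h⟩,
    fun ⟨_, ⟨U, hU, hg⟩, h⟩ => ⟨U, hU, fun i => by rw [h, hg, leftEnd_apply]⟩⟩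

theorem rightOrbitM_eq [Module Rᵐᵒᵖ M] (𝒰 : Subgroup (Matrix (Fin n) (Fin n) R)ˣ) :
    rightOrbitM R M n 𝒰 = endOrbit (rightEnds M 𝒰) := by
  funext v v'
  exact propext ⟨fun ⟨U, hU, h⟩ => ⟨_, ⟨U, hU, rfl⟩, funext h⟩,
    fun ⟨_, ⟨U, hU, hg⟩, h⟩ => ⟨U, hU, fun i => by rw [h, hg, rightEnd_apply]⟩⟩

theorem leftOrbitR_eq (𝒰 : Subgroup (Matrix (Fin n) (Fin n) R)ˣ) :
    leftOrbitR R n 𝒰 = endOrbit (leftEnds R 𝒰) := by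
  rw [← leftOrbitM_eq]
  funext v v'
  simp [leftOrbitR, leftOrbitM, funext_iff, Matrix.mulVec, dotProduct]

theorem rightOrbitR_eq (𝒰 : Subgroup (Matrix (Fin n) (Fin n) R)ˣ) :
    rightOrbitR R n 𝒰 = endOrbit (rightEnds R 𝒰) := by
  rw [← rightOrbitM_eq]
  funext v v'
  simp [rightOrbitR, rightOrbitM, funext_iff, Matrix.vecMul, dotProduct]

theorem sum_rightEnd_smul [Module R M] (U : Matrix (Fin n) (Fin n) R) (r : Fin n → R)
    (v : Fin n → M) : ∑ j, rightEnd R U r j • v j = ∑ i, r i • leftEnd M U v i := by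
  simp only [rightEnd_apply, leftEnd_apply, Finset.sum_smul, Finset.smul_sum, op_smul_eq_mul,
    mul_smul]
  exact Finset.sum_comm

/-- The coordinatewise extension of the pairing of `R` and `M` defined by a character `χ` and an
additive family of endomorphisms is perfect when `τ` identifies `R` with the characters of `M`. -/
theorem isCharPairing_sum [Finite M] (χ : AddChar M ℂˣ) (τ : R →+ AddMonoid.End M)
    (hinj : Function.Injective fun r : R => fun v : M => χ (τ r v))
    (hsurj : ∀ ψ : AddChar M ℂˣ, ∃ r : R, ∀ v : M, ψ v = χ (τ r v)) :
    IsCharPairing fun (r : Fin n → R) (v : Fin n → M) =>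
      ((χ (∑ i, τ (r i) (v i)) : ℂˣ) : ℂ) where
  add_left a a' b := by
    have hadd : ∀ i, τ ((a + a') i) (b i) = τ (a i) (b i) + τ (a' i) (b i) := fun i =>
      DFunLike.congr_fun (map_add τ (a i) (a' i)) (b i)
    simp only [hadd, Finset.sum_add_distrib, AddChar.map_add_eq_mul, Units.val_mul]
  add_right a b b' := by simp [Finset.sum_add_distrib, AddChar.map_add_eq_mul]
  zero_left b := by simp
  zero_right a := by simp
  inj_left a a' h := by
    funext i
    refine hinj (funext fun m => ?_)
    have hsum : ∀ r : Fin n → R, ∑ j, τ (r j) (Pi.single (M := fun _ => M) i m j) = τ (r i) m :=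
      fun r => by
        rw [Finset.sum_eq_single i (fun j _ hj => by simp [hj]) (by simp), Pi.single_eq_same]
    simpa only [hsum, Units.val_inj] using h (Pi.single i m)
  inj_right b b' h := by
    funext i
    have hχ : ∀ r, χ (τ r (b i)) = χ (τ r (b' i)) := fun r => by
      have hsum : ∀ v : Fin n → M, ∑ j, τ (Pi.single (M := fun _ => R) i r j) (v j) = τ r (v i) :=
        fun v => by
          rw [Finset.sum_eq_single i (fun j _ hj => by simp [hj]) (by simp), Pi.single_eq_same]
      simpa only [hsum, Units.val_inj] using h (Pi.single i r)
    rw [← sub_eq_zero, ← AddChar.forall_apply_eq_zero]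
    intro ψ
    obtain ⟨r, hr⟩ := hsurj (AddChar.toMonoidHomEquiv.symm ψ.toMonoidHom.toHomUnits)
    have hr' : ∀ v, ψ v = χ (τ r v) := fun v => congrArg Units.val (hr v)
    rw [hr', map_sub, sub_eq_add_neg, AddChar.map_add_eq_mul, hχ, ← AddChar.map_add_eq_mul,
      add_neg_cancel, AddChar.map_zero_eq_one, Units.val_one]

theorem IsGenChar.isCharPairing_left [Module R M] [Module Rᵐᵒᵖ M] [Finite M]
    {χ : AddChar M ℂˣ} (hχ : IsGenChar R M χ) :
    IsCharPairing fun (r : Fin n → R) (v : Fin n → M) => ((χ (∑ i, r i • v i) : ℂˣ) : ℂ) :=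
  isCharPairing_sum χ (Module.toAddMonoidEnd R M).toAddMonoidHom hχ.2.2.1 hχ.2.2.2

theorem IsGenChar.isCharPairing_right [Module R M] [Module Rᵐᵒᵖ M] [Finite M]
    {χ : AddChar M ℂˣ} (hχ : IsGenChar R M χ) :
    IsCharPairing fun (r : Fin n → R) (v : Fin n → M) => ((χ (∑ i, op (r i) • v i) : ℂˣ) : ℂ) :=
  isCharPairing_sum χ
    ((Module.toAddMonoidEnd Rᵐᵒᵖ M).toAddMonoidHom.comp (opAddEquiv (α := R)).toAddMonoidHom)
    hχ.1 hχ.2.1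

end MatrixActions

/-- Let `M` be a finite Frobenius bimodule over the finite ring `R` with generating
character `χ` and `𝒰 ≤ GL_n(R)` a subgroup.  Then (1) the orbit partition of `R^n` under
the right action of `𝒰` equals the `χ`-right dual of the orbit partition of `M^n` under
the left action of `𝒰`; (2) both actions have the same number of orbits; and (3) all four
orbit partitions (left/right actions of `𝒰` on `R^n` and on `M^n`) are reflexive, i.e.
each equals the `χ`-right dual of its `χ`-left dual. -/
theorem orbit_partition_duality (hχ : IsGenChar R M χ) :
    (∀ r r' : Fin n → R,
        rightOrbitR R n 𝒰 r r' ↔ dualRMR R M χ n (leftOrbitM R M n 𝒰) r r') ∧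
    Nat.card {S : Set (Fin n → R) // ∃ r, S = {r' | rightOrbitR R n 𝒰 r r'}} =
      Nat.card {S : Set (Fin n → M) // ∃ v, S = {v' | leftOrbitM R M n 𝒰 v v'}} ∧
    (∀ r r' : Fin n → R,
        rightOrbitR R n 𝒰 r r' ↔
          dualRMR R M χ n (dualLRM R M χ n (rightOrbitR R n 𝒰)) r r') ∧
    (∀ r r' : Fin n → R,
        leftOrbitR R n 𝒰 r r' ↔
          dualRMR R M χ n (dualLRM R M χ n (leftOrbitR R n 𝒰)) r r') ∧
    (∀ v v' : Fin n → M,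
        rightOrbitM R M n 𝒰 v v' ↔
          dualRRM R M χ n (dualLMR R M χ n (rightOrbitM R M n 𝒰)) v v') ∧
    (∀ v v' : Fin n → M,
        leftOrbitM R M n 𝒰 v v' ↔
          dualRRM R M χ n (dualLMR R M χ n (leftOrbitM R M n 𝒰)) v v') := by
  have hL := hχ.isCharPairing_left (n := n)
  have hR := hχ.isCharPairing_right (n := n)
  have hRR := isEndGroup_rightEnds (M := R) 𝒰
  have hLM := isEndGroup_leftEnds (M := M) 𝒰
  simp only [rightOrbitR_eq, leftOrbitR_eq, rightOrbitM_eq, leftOrbitM_eq]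
  have hdualM : ∀ v v', endOrbit (leftEnds M 𝒰) v v' →
      dualLRM R M χ n (endOrbit (rightEnds R 𝒰)) v v' := by
    intro v v' h
    refine hRR.charDual_of_endOrbit
      (e := fun (v : Fin n → M) (r : Fin n → R) => ((χ (∑ i, r i • v i) : ℂˣ) : ℂ)) ?_ h
    rintro _ ⟨U, hU, rfl⟩
    exact ⟨_, ⟨U, hU, rfl⟩, fun v r => by rw [sum_rightEnd_smul]⟩
  have hdualR : ∀ r r', endOrbit (rightEnds R 𝒰) r r' →
      dualRMR R M χ n (endOrbit (leftEnds M 𝒰)) r r' := by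
    intro r r' h
    refine hLM.charDual_of_endOrbit
      (e := fun (r : Fin n → R) (v : Fin n → M) => ((χ (∑ i, r i • v i) : ℂˣ) : ℂ)) ?_ h
    rintro _ ⟨U, hU, rfl⟩
    exact ⟨_, ⟨U, hU, rfl⟩, fun r v => by rw [sum_rightEnd_smul]⟩
  refine ⟨fun r r' => ⟨hdualR r r', hL.rel_of_charDual hRR.equivalence hLM.equivalence hdualM⟩, ?_,
    hRR.endOrbit_iff_bidual hL, (isEndGroup_leftEnds 𝒰).endOrbit_iff_bidual hL,
    (isEndGroup_rightEnds 𝒰).endOrbit_iff_bidual hR.flip, hLM.endOrbit_iff_bidual hR.flip⟩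
  have hcard := le_antisymm (hL.card_quotient_le hRR.equivalence hLM.equivalence hdualM)
    (hL.flip.card_quotient_le hLM.equivalence hRR.equivalence hdualR)
  exact (card_classes_eq hRR.equivalence).trans (hcard.trans (card_classes_eq hLM.equivalence).symm)

end
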